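/- Let w ∈ Ŵ be minuscule and let γ₁ ≠ γ₂ be roots in Δ⁺ \ I_w with w(δ − γᵢ) = βᵢ ∈ Π̂ for i = 1, 2 (so both I_w ∪ {γ₁} and I_w ∪ {γ₂} are abelian ideals, with minuscule elements s_{β₁}w and s_{β₂}w). Then: (1) if Ĩ := I_w ∪ {γ₁, γ₂} is not an abelian ideal, then β₁ and β₂ are long simple roots of Δ, w(α₀) + δ = β₁ + β₂, s_{β₁}w(α₀) + δ = β₂, and s_{β₂}w(α₀) + δ = β₁; (2) if Ĩ is an abelian ideal, then s_{β₁}s_{β₂} = s_{β₂}s_{β₁} and the minuscule element corresponding to Ĩ is s_{β₁}s_{β₂}w; (3) if s_{β₁}w(α₀) = w(α₀), then Ĩ is an abelian ideal and s_{β₁}s_{β₂}w(α₀) = s_{β₂}w(α₀). -/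

import Mathlib

open scoped BigOperators

/-- Data of a reduced irreducible crystallographic root system `Δ`, spanning a
`ℚ`-vector space `V` equipped with a Weyl-group-invariant inner product `B`,
together with a chosen system of positive roots `Pos` and the highest root `θ`. -/
structure RootSystemCtx (V : Type*) [AddCommGroup V] [Module ℚ V] where
  /-- the invariant inner product `( , )` -/
  B : V →ₗ[ℚ] V →ₗ[ℚ] ℚ
  B_symm : ∀ x y : V, B x y = B y x
  B_posdef : ∀ x : V, x ≠ 0 → 0 < B x x
  /-- the set of roots -/
  Δ : Set V
  Δ_finite : Δ.Finite
  Δ_spans : Submodule.span ℚ Δ = ⊤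
  zero_notMem_Δ : (0 : V) ∉ Δ
  neg_mem_Δ : ∀ α ∈ Δ, -α ∈ Δ
  reduced : ∀ α ∈ Δ, ∀ c : ℚ, c • α ∈ Δ → c = 1 ∨ c = -1
  crystallographic : ∀ α ∈ Δ, ∀ β ∈ Δ, ∃ n : ℤ, 2 * B α β / B β β = (n : ℚ)
  reflect_mem : ∀ α ∈ Δ, ∀ β ∈ Δ, β - (2 * B β α / B α α) • α ∈ Δ
  irreducible : ∀ S : Set V, S ⊆ Δ → (∀ α ∈ S, ∀ β ∈ Δ \ S, B α β = 0) → S = ∅ ∨ S = Δ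
  /-- the positive roots `Δ⁺` -/
  Pos : Set V
  pos_subset : Pos ⊆ Δ
  mem_pos_or_neg_pos : ∀ α ∈ Δ, α ∈ Pos ∨ -α ∈ Pos
  pos_not_neg : ∀ α ∈ Pos, -α ∉ Pos
  add_pos_mem : ∀ α ∈ Pos, ∀ β ∈ Pos, α + β ∈ Δ → α + β ∈ Pos
  /-- the highest root `θ` -/
  θ : V
  θ_pos : θ ∈ Pos
  θ_highest : ∀ ν ∈ Δ, θ - ν ∈ AddSubmonoid.closure Pos

namespace RootSystemCtx

variable {V : Type*} [AddCommGroup V] [Module ℚ V] (ctx : RootSystemCtx V)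

/-- the simple roots `Π`: indecomposable positive roots -/
def simple : Set V :=
  {α | α ∈ ctx.Pos ∧ ¬∃ β ∈ ctx.Pos, ∃ γ ∈ ctx.Pos, α = β + γ}

/-- `ρ`, the half-sum of all positive roots -/
noncomputable def ρ : V :=
  (1 / 2 : ℚ) • ∑ α ∈ (ctx.Δ_finite.subset ctx.pos_subset).toFinset, α

/-- the coroot `μ∨ = 2μ/(μ,μ)` -/
noncomputable def coroot (μ : V) : V := (2 / ctx.B μ μ) • μ

/-- `Δ⁺_l`, the long positive roots (roots of the same length as `θ`) -/
def PosLong : Set V := {μ | μ ∈ ctx.Pos ∧ ctx.B μ μ = ctx.B ctx.θ ctx.θ}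

/-- `Π_l`, the long simple roots -/
def SimpleLong : Set V := {μ | μ ∈ ctx.simple ∧ ctx.B μ μ = ctx.B ctx.θ ctx.θ}

/-- the dominance order `μ ≼ ν` on the root lattice: `ν - μ` is a nonnegative
integer combination of positive roots -/
def le (μ ν : V) : Prop := ν - μ ∈ AddSubmonoid.closure ctx.Pos

/-- a (combinatorial) abelian ideal of `Δ⁺` -/
def IsAbelianIdeal (I : Set V) : Prop :=
  I ⊆ ctx.Pos ∧ (∀ μ ∈ I, ∀ ν ∈ I, μ + ν ∉ ctx.Δ) ∧
    ∀ γ ∈ I, ∀ ν ∈ ctx.Pos, γ + ν ∈ ctx.Δ → γ + ν ∈ I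

/-- `γ` is a generator of the ideal `I` -/
def IsGenerator (I : Set V) (γ : V) : Prop := γ ∈ I ∧ ∀ α ∈ ctx.Pos, γ - α ∉ I

/-! ### The affine picture: `V̂ = V ⊕ ℚδ ⊕ ℚλ`, modelled as `V × ℚ × ℚ`,
with `δ = (0,1,0)` and `λ = (0,0,1)`. -/

/-- the embedding of `V` into `V̂` -/
def emb (_ctx : RootSystemCtx V) (v : V) : V × ℚ × ℚ := (v, 0, 0)

/-- the imaginary root `δ` -/
def δhat (_ctx : RootSystemCtx V) : V × ℚ × ℚ := (0, 1, 0)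

/-- the affine simple root `α₀ = δ - θ` -/
def alpha0 : V × ℚ × ℚ := (-ctx.θ, 1, 0)

/-- the extension of the inner product to `V̂`, with
`(δ,V)=(λ,V)=(δ,δ)=(λ,λ)=0` and `(δ,λ)=1` -/
noncomputable def Bhat : (V × ℚ × ℚ) →ₗ[ℚ] (V × ℚ × ℚ) →ₗ[ℚ] ℚ :=
  LinearMap.mk₂ ℚ (fun x y => ctx.B x.1 y.1 + x.2.1 * y.2.2 + x.2.2 * y.2.1)
    (fun x x' y => by
      simp only [Prod.fst_add, Prod.snd_add, map_add, LinearMap.add_apply]; ring)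
    (fun c x y => by
      simp only [Prod.smul_fst, Prod.smul_snd, map_smul, LinearMap.smul_apply,
        smul_eq_mul]; ring)
    (fun x y y' => by
      simp only [Prod.fst_add, Prod.snd_add, map_add]; ring)
    (fun c x y => by
      simp only [Prod.smul_fst, Prod.smul_snd, map_smul, smul_eq_mul]; ring)

/-- the set `Δ̂` of affine real roots -/
def Δhat : Set (V × ℚ × ℚ) := {x | ∃ α ∈ ctx.Δ, ∃ k : ℤ, x = (α, (k : ℚ), 0)}

/-- the set `Δ̂⁺` of positive affine roots -/
def PosHat : Set (V × ℚ × ℚ) :=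
  {x | ∃ α ∈ ctx.Pos, x = (α, 0, 0)} ∪
    {x | ∃ α ∈ ctx.Δ, ∃ k : ℤ, 1 ≤ k ∧ x = (α, (k : ℚ), 0)}

/-- the set `Π̂ = Π ∪ {α₀}` of affine simple roots -/
def SimpleHat : Set (V × ℚ × ℚ) :=
  {x | ∃ α ∈ ctx.simple, x = (α, (0 : ℚ), (0 : ℚ))} ∪ {ctx.alpha0}

/-- the reflection `s_β : x ↦ x − (2(x,β)/(β,β))·β` in `V̂` -/
noncomputable def refl (β : V × ℚ × ℚ) : (V × ℚ × ℚ) ≃ₗ[ℚ] (V × ℚ × ℚ) :=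
  if h : ctx.Bhat β β = 0 then LinearEquiv.refl ℚ _
  else
    Module.reflection (x := β) (f := (2 / ctx.Bhat β β) • ctx.Bhat β)
      (by simp only [LinearMap.smul_apply, smul_eq_mul]; field_simp)

/-- the affine Weyl group `Ŵ`, generated by the reflections `s_β`, `β ∈ Δ̂` -/
def What : Subgroup ((V × ℚ × ℚ) ≃ₗ[ℚ] (V × ℚ × ℚ)) :=
  Subgroup.closure {g | ∃ β ∈ ctx.Δhat, g = ctx.refl β}

/-- the finite Weyl group `W`, generated by the reflections `s_α`, `α ∈ Δ`
(identified with a subgroup of `Ŵ`) -/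
def Wfin : Subgroup ((V × ℚ × ℚ) ≃ₗ[ℚ] (V × ℚ × ℚ)) :=
  Subgroup.closure {g | ∃ α ∈ ctx.Δ, g = ctx.refl (α, (0 : ℚ), (0 : ℚ))}

/-- `N̂(w) = {β ∈ Δ̂⁺ : w(β) ∈ −Δ̂⁺}` -/
def Nhat (w : (V × ℚ × ℚ) ≃ₗ[ℚ] (V × ℚ × ℚ)) : Set (V × ℚ × ℚ) :=
  {β | β ∈ ctx.PosHat ∧ -(w β) ∈ ctx.PosHat}

/-- a minuscule element of `Ŵ`: every element of `N̂(w)` has the form `δ - γ`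
with `γ ∈ Δ⁺` -/
def IsMinuscule (w : (V × ℚ × ℚ) ≃ₗ[ℚ] (V × ℚ × ℚ)) : Prop :=
  w ∈ ctx.What ∧ ∀ β ∈ ctx.Nhat w, ∃ γ ∈ ctx.Pos, β = ctx.δhat - ctx.emb γ

/-- the abelian ideal `I_w` corresponding to a minuscule element `w` -/
def idealOf (w : (V × ℚ × ℚ) ≃ₗ[ℚ] (V × ℚ × ℚ)) : Set V :=
  {γ | γ ∈ ctx.Pos ∧ ctx.δhat - ctx.emb γ ∈ ctx.Nhat w}

/-- the ideal `I` has rootlet `τ(I) = μ`, i.e. `I = I_w` for some minuscule `w`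
with `w(α₀) + δ = μ` -/
def HasRootlet (I : Set V) (μ : V) : Prop :=
  ∃ w, ctx.IsMinuscule w ∧ ctx.idealOf w = I ∧ w ctx.alpha0 + ctx.δhat = ctx.emb μ

/-- `Ab_μ`, the set of nonempty abelian ideals with rootlet `μ` -/
def AbFiber (μ : V) : Set (Set V) := {I | I.Nonempty ∧ ctx.HasRootlet I μ}

/-- `N(u) = {γ ∈ Δ⁺ : u(γ) ∈ −Δ⁺}` for `u` in the finite Weyl group -/
def Nfin (w : (V × ℚ × ℚ) ≃ₗ[ℚ] (V × ℚ × ℚ)) : Set V :=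
  {γ | γ ∈ ctx.Pos ∧ -(w (ctx.emb γ)) ∈ ctx.PosHat}

/-- the length `l(u) = #N(u)` of an element of the finite Weyl group -/
noncomputable def lenFin (w : (V × ℚ × ℚ) ≃ₗ[ℚ] (V × ℚ × ℚ)) : ℕ :=
  (ctx.Nfin w).ncard

end RootSystemCtx

namespace RootSystemCtx

variable {V : Type*} [AddCommGroup V] [Module ℚ V] (ctx : RootSystemCtx V)

/-! ### Finite root systems -/

lemma ne_zero_of_mem {α : V} (h : α ∈ ctx.Δ) : α ≠ 0 :=
  fun h0 => ctx.zero_notMem_Δ (h0 ▸ h)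

lemma B_self_pos {α : V} (h : α ∈ ctx.Δ) : 0 < ctx.B α α :=
  ctx.B_posdef α (ctx.ne_zero_of_mem h)

lemma add_ne_zero_of_pos {α β : V} (hα : α ∈ ctx.Pos) (hβ : β ∈ ctx.Pos) : α + β ≠ 0 := by
  intro h
  apply ctx.pos_not_neg α hα
  rwa [← eq_neg_of_add_eq_zero_right h]

/-- For roots at an obtuse angle that are not opposite, one of the two Cartan integers is `-1`. -/
lemma cartan_eq_neg_one {α β : V} (hα : α ∈ ctx.Δ) (hβ : β ∈ ctx.Δ) (hneg : ctx.B α β < 0)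
    (hne : α + β ≠ 0) : 2 * ctx.B α β = -ctx.B β β ∨ 2 * ctx.B α β = -ctx.B α α := by
  obtain ⟨p, hp⟩ := ctx.crystallographic α hα β hβ
  obtain ⟨q, hq⟩ := ctx.crystallographic β hβ α hα
  have hα0 := ctx.B_self_pos hα
  have hβ0 := ctx.B_self_pos hβ
  rw [ctx.B_symm β α, div_eq_iff hα0.ne'] at hq
  rw [div_eq_iff hβ0.ne'] at hp
  have hsum := ctx.B_posdef _ hne
  simp only [map_add, LinearMap.add_apply, ctx.B_symm β α] at hsum
  have hp0 : (p : ℚ) < 0 := by by_contra! h; nlinarith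
  have hq0 : (q : ℚ) < 0 := by by_contra! h; nlinarith
  have hp1 : p ≤ -1 := by have : p < 0 := by exact_mod_cast hp0
                          omega
  have hq1 : q ≤ -1 := by have : q < 0 := by exact_mod_cast hq0
                          omega
  by_cases hp2 : p = -1
  · left; rw [hp, hp2]; push_cast; ring
  by_cases hq2 : q = -1
  · right; rw [hq, hq2]; push_cast; ring
  exfalso
  have hp3 : (p : ℚ) ≤ -2 := by exact_mod_cast (by omega : p ≤ -2)
  have hq3 : (q : ℚ) ≤ -2 := by exact_mod_cast (by omega : q ≤ -2)
  nlinarith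

lemma add_mem_of_B_neg {α β : V} (hα : α ∈ ctx.Δ) (hβ : β ∈ ctx.Δ) (hneg : ctx.B α β < 0)
    (hne : α + β ≠ 0) : α + β ∈ ctx.Δ := by
  rcases ctx.cartan_eq_neg_one hα hβ hneg hne with h | h
  · have := ctx.reflect_mem β hβ α hα
    rw [h, neg_div, div_self (ctx.B_self_pos hβ).ne'] at this
    simpa using this
  · have := ctx.reflect_mem α hα β hβ
    rw [ctx.B_symm β α, h, neg_div, div_self (ctx.B_self_pos hα).ne'] at this
    simpa [add_comm] using this

lemma sub_mem_of_B_pos {α β : V} (hα : α ∈ ctx.Δ) (hβ : β ∈ ctx.Δ) (hpos : 0 < ctx.B α β)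
    (hne : α ≠ β) : α - β ∈ ctx.Δ := by
  rw [sub_eq_add_neg]
  exact ctx.add_mem_of_B_neg hα (ctx.neg_mem_Δ β hβ) (by simpa using hpos)
    (by simpa [← sub_eq_add_neg, sub_eq_zero] using hne)

/-- Reflecting `α + β` in `β` when `α` and `β` are orthogonal. -/
lemma sub_mem_of_orthogonal {α β : V} (hβ : β ∈ ctx.Δ) (hadd : α + β ∈ ctx.Δ)
    (h0 : ctx.B α β = 0) : α - β ∈ ctx.Δ := by
  have h := ctx.reflect_mem β hβ _ hadd
  have hβ0 := (ctx.B_self_pos hβ).ne'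
  have h2 : 2 * ctx.B (α + β) β / ctx.B β β = 2 := by
    simp only [map_add, LinearMap.add_apply, h0]; field_simp; ring
  rw [h2] at h
  convert h using 1
  module

lemma multiset_sum_ne_zero (s : Multiset V) (hs : ∀ α ∈ s, α ∈ ctx.Pos) (h0 : s ≠ 0) :
    s.sum ≠ 0 := by
  induction hn : s.card generalizing s with
  | zero => exact absurd (Multiset.card_eq_zero.mp hn) h0
  | succ n ih =>
    obtain ⟨a, t, rfl⟩ : ∃ a t, s = a ::ₘ t := by
      obtain ⟨a, ha⟩ := Multiset.exists_mem_of_ne_zero h0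
      obtain ⟨t, ht⟩ := Multiset.exists_cons_of_mem ha
      exact ⟨a, t, ht⟩
    intro hsum
    have ha := hs a (Multiset.mem_cons_self a t)
    have haa := ctx.B_self_pos (ctx.pos_subset ha)
    by_cases hex : ∃ b ∈ t, ctx.B a b < 0
    · obtain ⟨b, hb, hab⟩ := hex
      obtain ⟨u, rfl⟩ := Multiset.exists_cons_of_mem hb
      have hbp := hs b (by simp)
      have hmem := ctx.add_pos_mem a ha b hbp (ctx.add_mem_of_B_neg (ctx.pos_subset ha)
        (ctx.pos_subset hbp) hab (ctx.add_ne_zero_of_pos ha hbp))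
      refine ih ((a + b) ::ₘ u) ?_ (by simp) (by simpa using hn) ?_
      · intro c hc
        rcases Multiset.mem_cons.mp hc with rfl | hc
        · exact hmem
        · exact hs c (by simp [hc])
      · simpa [add_assoc] using hsum
    · push Not at hex
      have h1 : ctx.B a (a ::ₘ t).sum = ctx.B a a + (t.map (ctx.B a)).sum := by
        simp [map_multiset_sum]
      have h2 : 0 ≤ (t.map (ctx.B a)).sum :=
        Multiset.sum_nonneg (by simpa using hex)
      rw [hsum, map_zero] at h1
      linarith

lemma add_ne_zero_of_mem_closure {x p : V} (hx : x ∈ AddSubmonoid.closure ctx.Pos)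
    (hp : p ∈ ctx.Pos) : x + p ≠ 0 := by
  obtain ⟨s, hs, rfl⟩ := AddSubmonoid.exists_multiset_of_mem_closure hx
  have := ctx.multiset_sum_ne_zero (p ::ₘ s)
    (by simpa [hp] using hs) (by simp)
  simpa [add_comm] using this

lemma eq_zero_of_mem_closure {x : V} (hx : x ∈ AddSubmonoid.closure ctx.Pos)
    (hx' : -x ∈ AddSubmonoid.closure ctx.Pos) : x = 0 := by
  obtain ⟨s, hs, hsx⟩ := AddSubmonoid.exists_multiset_of_mem_closure hx
  by_contra h0
  have hs0 : s ≠ 0 := by rintro rfl; exact h0 (by simpa using hsx.symm)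
  obtain ⟨a, ha⟩ := Multiset.exists_mem_of_ne_zero hs0
  obtain ⟨t, rfl⟩ := Multiset.exists_cons_of_mem ha
  have ht : t.sum ∈ AddSubmonoid.closure ctx.Pos :=
    AddSubmonoid.multiset_sum_mem _ _ fun b hb => AddSubmonoid.subset_closure (hs b (by simp [hb]))
  apply ctx.add_ne_zero_of_mem_closure (add_mem ht hx') (hs a ha)
  rw [← hsx]
  simp

lemma θ_mem : ctx.θ ∈ ctx.Δ := ctx.pos_subset ctx.θ_pos

lemma θ_add_notMem {ν : V} (hν : ν ∈ ctx.Pos) : ctx.θ + ν ∉ ctx.Δ := by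
  intro h
  have h1 := ctx.θ_highest _ h
  exact ctx.add_ne_zero_of_mem_closure h1 hν (by simp)

lemma B_θ_nonneg {ν : V} (hν : ν ∈ ctx.Pos) : 0 ≤ ctx.B ctx.θ ν := by
  by_contra! h
  exact ctx.θ_add_notMem hν (ctx.add_mem_of_B_neg ctx.θ_mem (ctx.pos_subset hν) h
    (ctx.add_ne_zero_of_pos ctx.θ_pos hν))

/-- A positive root to which no positive root can be added is the highest root. -/
lemma eq_θ_of_maximal {η : V} (hη : η ∈ ctx.Pos) (hmax : ∀ ν ∈ ctx.Pos, η + ν ∉ ctx.Δ) :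
    η = ctx.θ := by
  have hη' := ctx.pos_subset hη
  have hnn : ∀ ν ∈ ctx.Pos, 0 ≤ ctx.B η ν := by
    intro ν hν
    by_contra! h
    exact hmax ν hν (ctx.add_mem_of_B_neg hη' (ctx.pos_subset hν) h (ctx.add_ne_zero_of_pos hη hν))
  have hcl : ∀ x ∈ AddSubmonoid.closure ctx.Pos, 0 ≤ ctx.B η x := by
    intro x hx
    induction hx using AddSubmonoid.closure_induction with
    | mem x hx => exact hnn x hx
    | zero => simp
    | add x y _ _ hx hy => rw [map_add]; exact add_nonneg hx hy
  have h1 := hcl _ (ctx.θ_highest η hη')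
  rw [map_sub] at h1
  have h2 := ctx.B_self_pos hη'
  by_contra hne
  have h3 := ctx.sub_mem_of_B_pos ctx.θ_mem hη' (by rw [ctx.B_symm]; linarith) (Ne.symm hne)
  rcases ctx.mem_pos_or_neg_pos _ h3 with h4 | h4
  · exact hmax _ h4 (by simpa using ctx.θ_mem)
  · exact ctx.θ_add_notMem h4 (by simpa using hη')

/-- The Cartan integer of a positive root against `θ` is at most `1`, except for `θ` itself. -/
lemma eq_θ_of_two_le {p : V} (hp : p ∈ ctx.Pos)
    (h : 2 ≤ 2 * ctx.B p ctx.θ / ctx.B ctx.θ ctx.θ) : p = ctx.θ := by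
  obtain ⟨m, hm⟩ := ctx.crystallographic p (ctx.pos_subset hp) _ ctx.θ_mem
  have hq := ctx.reflect_mem _ ctx.θ_mem p (ctx.pos_subset hp)
  rw [hm] at h hq
  have hm2 : 2 ≤ m := by exact_mod_cast h
  obtain ⟨k, rfl⟩ : ∃ k : ℕ, m = k + 2 := ⟨(m - 2).toNat, by omega⟩
  have h1 := ctx.θ_highest _ (ctx.neg_mem_Δ _ hq)
  have h2 := ctx.θ_highest _ (ctx.pos_subset hp)
  have h3 : -(ctx.θ - p) = (ctx.θ - -(p - ((k + 2 : ℤ) : ℚ) • ctx.θ)) + k • ctx.θ := by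
    rw [← Nat.cast_smul_eq_nsmul ℚ]
    push_cast
    module
  have h4 : -(ctx.θ - p) ∈ AddSubmonoid.closure ctx.Pos := by
    rw [h3]
    exact add_mem h1 (nsmul_mem (AddSubmonoid.subset_closure ctx.θ_pos) k)
  exact (sub_eq_zero.mp (ctx.eq_zero_of_mem_closure h2 h4)).symm

/-- If `γ₁ + γ₂ + ν` is a root then so is `γ₁ + ν` or `γ₂ + ν`. -/
lemma add_mem_or_add_mem {γ₁ γ₂ ν : V} (h1 : γ₁ ∈ ctx.Pos) (h2 : γ₂ ∈ ctx.Pos)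
    (h12 : γ₁ + γ₂ ∈ ctx.Δ) (hν : ν ∈ ctx.Pos) (h : γ₁ + γ₂ + ν ∈ ctx.Δ) :
    γ₁ + ν ∈ ctx.Δ ∨ γ₂ + ν ∈ ctx.Δ := by
  by_cases ha : 0 < ctx.B (γ₁ + γ₂ + ν) γ₁
  · right
    have := ctx.sub_mem_of_B_pos h (ctx.pos_subset h1) ha
      (fun h => ctx.add_ne_zero_of_pos h2 hν (by rw [add_assoc] at h; simpa using h))
    convert this using 1; abel
  by_cases hb : 0 < ctx.B (γ₁ + γ₂ + ν) γ₂
  · left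
    have := ctx.sub_mem_of_B_pos h (ctx.pos_subset h2) hb
      (fun h => ctx.add_ne_zero_of_pos h1 hν (by
        rw [add_comm γ₁, add_assoc] at h; simpa using h))
    convert this using 1; abel
  push Not at ha hb
  have hpos := ctx.B_self_pos h12
  have e1 := ctx.B_symm γ₁ γ₂
  have e2 := ctx.B_symm γ₁ ν
  have e3 := ctx.B_symm γ₂ ν
  simp only [map_add, LinearMap.add_apply] at ha hb hpos
  by_cases hc : ctx.B γ₁ ν < 0
  · exact Or.inl (ctx.add_mem_of_B_neg (ctx.pos_subset h1) (ctx.pos_subset hν) hc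
      (ctx.add_ne_zero_of_pos h1 hν))
  · exact Or.inr (ctx.add_mem_of_B_neg (ctx.pos_subset h2) (ctx.pos_subset hν) (by linarith)
      (ctx.add_ne_zero_of_pos h2 hν))

lemma sub_notMem_of_simple {α β : V} (hα : α ∈ ctx.simple) (hβ : β ∈ ctx.simple) :
    α - β ∉ ctx.Δ := by
  intro h
  rcases ctx.mem_pos_or_neg_pos _ h with h | h
  · exact hα.2 ⟨_, h, β, hβ.1, by simp⟩
  · exact hβ.2 ⟨_, h, α, hα.1, by simp⟩

lemma B_neg_of_simple {α β : V} (hα : α ∈ ctx.simple) (hβ : β ∈ ctx.simple) (hne : α ≠ β)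
    (hadd : α + β ∈ ctx.Δ) : ctx.B α β < 0 := by
  rcases lt_trichotomy (ctx.B α β) 0 with h | h | h
  · exact h
  · exact absurd (ctx.sub_mem_of_orthogonal (ctx.pos_subset hβ.1) hadd h)
      (ctx.sub_notMem_of_simple hα hβ)
  · exact absurd (ctx.sub_mem_of_B_pos (ctx.pos_subset hα.1) (ctx.pos_subset hβ.1) h hne)
      (ctx.sub_notMem_of_simple hα hβ)

lemma exists_smul_of_add_eq {b : V} (hb : b ∈ ctx.simple) (m : ℕ) {a c : V} (ha : a ∈ ctx.Pos)
    (hc : c ∈ ctx.Pos) (h : a + c = (m : ℚ) • b) : ∃ r : ℚ, a = r • b := by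
  have hbΔ := ctx.pos_subset hb.1
  have key : ∀ {x : V}, x ∈ ctx.Pos → 0 < ctx.B x b → x ≠ b → x - b ∈ ctx.Pos := by
    intro x hx hxb hne
    rcases ctx.mem_pos_or_neg_pos _ (ctx.sub_mem_of_B_pos (ctx.pos_subset hx) hbΔ hxb hne)
      with h | h
    · exact h
    · exact absurd ⟨x, hx, _, h, by abel⟩ hb.2
  induction m generalizing a c with
  | zero => exact absurd (by simpa using h) (ctx.add_ne_zero_of_pos ha hc)
  | succ m ih =>
    push_cast at h
    by_cases hab : a = b
    · exact ⟨1, by simp [hab]⟩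
    by_cases hcb : c = b
    · exact ⟨m, by rw [eq_sub_of_add_eq h, hcb]; module⟩
    have hB : ctx.B a b + ctx.B c b = (m + 1) * ctx.B b b := by
      rw [← LinearMap.add_apply, ← map_add, h]; simp
    have hpos : 0 < ctx.B a b + ctx.B c b := by
      rw [hB]; have := ctx.B_self_pos hbΔ; positivity
    by_cases hab' : 0 < ctx.B a b
    · obtain ⟨r, hr⟩ := ih (key ha hab' hab) hc
        (by rw [sub_add_eq_add_sub, h]; module)
      exact ⟨r + 1, by rw [eq_add_of_sub_eq hr]; module⟩
    · obtain ⟨r, hr⟩ := ih ha (key hc (by linarith) hcb)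
        (by rw [← add_sub_assoc, h]; module)
      exact ⟨r, hr⟩

/-- A simple reflection permutes the positive roots other than the simple root. -/
lemma reflect_pos_of_simple {a b : V} (hb : b ∈ ctx.simple) (ha : a ∈ ctx.Pos) (hne : a ≠ b) :
    a - (2 * ctx.B a b / ctx.B b b) • b ∈ ctx.Pos := by
  have haΔ := ctx.pos_subset ha
  have hbΔ := ctx.pos_subset hb.1
  have hmem := ctx.reflect_mem b hbΔ a haΔ
  obtain ⟨m, hm⟩ := ctx.crystallographic a haΔ b hbΔ
  rw [hm] at hmem ⊢
  refine (ctx.mem_pos_or_neg_pos _ hmem).resolve_right fun hc => ?_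
  rcases le_total 0 m with h0 | h0
  · lift m to ℕ using h0
    obtain ⟨r, hr⟩ := ctx.exists_smul_of_add_eq hb m ha hc (by push_cast; abel)
    rcases ctx.reduced b hbΔ r (hr ▸ haΔ) with rfl | rfl
    · exact hne (by simpa using hr)
    · exact ctx.pos_not_neg b hb.1 (by simpa [hr] using ha)
  · obtain ⟨k, rfl⟩ : ∃ k : ℕ, m = -k := ⟨(-m).toNat, by omega⟩
    refine ctx.add_ne_zero_of_mem_closure (add_mem (AddSubmonoid.subset_closure hc)
      (nsmul_mem (AddSubmonoid.subset_closure hb.1) k)) ha ?_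
    rw [← Nat.cast_smul_eq_nsmul ℚ]
    push_cast
    module

/-! ### The coroot lattice -/

/-- The set of coroots. -/
def coroots : Set V := ctx.coroot '' ctx.Δ

lemma B_coroot (α x : V) : ctx.B (ctx.coroot α) x = 2 * ctx.B α x / ctx.B α α := by
  simp only [coroot, map_smul, LinearMap.smul_apply, smul_eq_mul]; ring

lemma B_coroot_self {α : V} (h : α ∈ ctx.Δ) : ctx.B (ctx.coroot α) α = 2 := by
  rw [B_coroot]; have := (ctx.B_self_pos h).ne'; field_simp

lemma neg_mem_coroots {c : V} (h : c ∈ ctx.coroots) : -c ∈ ctx.coroots := by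
  obtain ⟨α, hα, rfl⟩ := h
  exact ⟨-α, ctx.neg_mem_Δ α hα, by simp [coroot]⟩

/-- Reflecting `β` in `α`, on the level of coroots, when `⟨α, β^∨⟩ = -1`. -/
lemma coroot_add_mem_of_cartan {α β : V} (hα : α ∈ ctx.Δ) (hβ : β ∈ ctx.Δ)
    (h : 2 * ctx.B α β = -ctx.B β β) : ctx.coroot α + ctx.coroot β ∈ ctx.coroots := by
  have hα0 := (ctx.B_self_pos hα).ne'
  have hβ0 := (ctx.B_self_pos hβ).ne'
  refine ⟨_, ctx.reflect_mem α hα β hβ, ?_⟩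
  have e : ctx.B α β = -ctx.B β β / 2 := by linarith
  have hlen : ctx.B (β - (2 * ctx.B β α / ctx.B α α) • α) (β - (2 * ctx.B β α / ctx.B α α) • α)
      = ctx.B β β := by
    simp only [map_sub, map_smul, LinearMap.sub_apply, LinearMap.smul_apply, smul_eq_mul,
      ctx.B_symm β α]
    field_simp
    ring
  rw [coroot, hlen, ctx.B_symm β α, e, coroot, coroot, smul_sub, smul_smul, add_comm,
    sub_eq_add_neg, ← neg_smul]
  congr 2
  field_simp

lemma coroot_add_mem {α β : V} (hα : α ∈ ctx.Δ) (hβ : β ∈ ctx.Δ) (hneg : ctx.B α β < 0)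
    (hne : α + β ≠ 0) : ctx.coroot α + ctx.coroot β ∈ ctx.coroots := by
  rcases ctx.cartan_eq_neg_one hα hβ hneg hne with h | h
  · exact ctx.coroot_add_mem_of_cartan hα hβ h
  · rw [add_comm]
    exact ctx.coroot_add_mem_of_cartan hβ hα (by rw [ctx.B_symm]; exact h)

/-- A sum of coroots pairing with every root to less than `2` vanishes. -/
lemma multiset_coroot_sum_eq_zero (s : Multiset V) (hs : ∀ c ∈ s, c ∈ ctx.coroots)
    (hz : ∀ α ∈ ctx.Δ, ctx.B s.sum α < 2) : s.sum = 0 := by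
  induction hn : s.card using Nat.strong_induction_on generalizing s with
  | _ n ih =>
    by_cases h0 : s = 0
    · simp [h0]
    obtain ⟨c, hc⟩ := Multiset.exists_mem_of_ne_zero h0
    obtain ⟨t, rfl⟩ := Multiset.exists_cons_of_mem hc
    obtain ⟨α, hα, rfl⟩ := hs c hc
    by_cases hex : ∃ b ∈ t, ctx.B b α < 0
    · obtain ⟨b, hb, hbα⟩ := hex
      obtain ⟨u, rfl⟩ := Multiset.exists_cons_of_mem hb
      obtain ⟨β, hβ, rfl⟩ := hs b (by simp)
      have hβ0 := ctx.B_self_pos hβ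
      have hαβ : ctx.B α β < 0 := by
        rw [B_coroot, div_lt_iff₀ hβ0, ctx.B_symm] at hbα; linarith
      by_cases hne : α + β = 0
      · have hsum : (ctx.coroot α ::ₘ ctx.coroot β ::ₘ u).sum = u.sum := by
          obtain rfl := eq_neg_of_add_eq_zero_right hne
          simp [coroot]
        rw [hsum] at hz ⊢
        exact ih u.card (by rw [← hn]; simp) u (fun c hc => hs c (by simp [hc])) hz rfl
      · have hsum : (ctx.coroot α ::ₘ ctx.coroot β ::ₘ u).sum
            = ((ctx.coroot α + ctx.coroot β) ::ₘ u).sum := by simp [add_assoc]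
        rw [hsum] at hz ⊢
        refine ih _ (by rw [← hn]; simp) _ (fun c hc => ?_) hz rfl
        rcases Multiset.mem_cons.mp hc with rfl | hc
        · exact ctx.coroot_add_mem hα hβ hαβ hne
        · exact hs c (by simp [hc])
    · push Not at hex
      exfalso
      have h1 : ctx.B (ctx.coroot α ::ₘ t).sum α = 2 + (t.map fun b => ctx.B b α).sum := by
        have h := map_multiset_sum (ctx.B.flip α) t
        simp only [LinearMap.flip_apply] at h
        rw [Multiset.sum_cons, map_add, LinearMap.add_apply, B_coroot_self _ hα, h]
        rfl
      have h2 : 0 ≤ (t.map fun b => ctx.B b α).sum :=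
        Multiset.sum_nonneg (by simpa using hex)
      have h3 := hz α hα
      linarith

lemma eq_zero_of_mem_coroot_lattice {z : V} (hz : z ∈ AddSubgroup.closure ctx.coroots)
    (h : ∀ α ∈ ctx.Δ, ctx.B z α < 2) : z = 0 := by
  have hz' : z ∈ AddSubmonoid.closure ctx.coroots := by
    rw [← AddSubgroup.mem_toAddSubmonoid, AddSubgroup.closure_toAddSubmonoid] at hz
    refine AddSubmonoid.closure_mono (Set.union_subset subset_rfl fun x hx => ?_) hz
    simpa using ctx.neg_mem_coroots hx
  obtain ⟨s, hs, rfl⟩ := AddSubmonoid.exists_multiset_of_mem_closure hz'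
  exact ctx.multiset_coroot_sum_eq_zero s hs h

lemma exists_int_of_mem_coroot_lattice {z : V} (hz : z ∈ AddSubgroup.closure ctx.coroots)
    {α : V} (hα : α ∈ ctx.Δ) : ∃ n : ℤ, ctx.B z α = n := by
  induction hz using AddSubgroup.closure_induction with
  | mem x hx =>
    obtain ⟨β, hβ, rfl⟩ := hx
    obtain ⟨n, hn⟩ := ctx.crystallographic α hα β hβ
    exact ⟨n, by rw [B_coroot, ctx.B_symm, hn]⟩
  | zero => exact ⟨0, by simp⟩
  | add x y _ _ hx hy =>
    obtain ⟨m, hm⟩ := hx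
    obtain ⟨n, hn⟩ := hy
    exact ⟨m + n, by simp [hm, hn]⟩
  | neg x _ hx =>
    obtain ⟨m, hm⟩ := hx
    exact ⟨-m, by simp [hm]⟩

/-! ### The affine Weyl group -/

lemma Bhat_apply (x y : V × ℚ × ℚ) :
    ctx.Bhat x y = ctx.B x.1 y.1 + x.2.1 * y.2.2 + x.2.2 * y.2.1 := rfl

lemma Bhat_symm (x y : V × ℚ × ℚ) : ctx.Bhat x y = ctx.Bhat y x := by
  simp only [Bhat_apply, ctx.B_symm x.1 y.1]; ring

lemma Bhat_self_pos {β : V × ℚ × ℚ} (hβ : β ∈ ctx.Δhat) : 0 < ctx.Bhat β β := by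
  obtain ⟨b, hb, k, rfl⟩ := hβ
  simpa [Bhat_apply] using ctx.B_self_pos hb

lemma refl_apply {β : V × ℚ × ℚ} (hβ : β ∈ ctx.Δhat) (x : V × ℚ × ℚ) :
    ctx.refl β x = x - (2 * ctx.Bhat x β / ctx.Bhat β β) • β := by
  have h := (ctx.Bhat_self_pos hβ).ne'
  rw [refl, dif_neg h, Module.reflection_apply]
  simp only [LinearMap.smul_apply, smul_eq_mul, ctx.Bhat_symm x β]
  congr 2
  ring

lemma refl_self {β : V × ℚ × ℚ} (hβ : β ∈ ctx.Δhat) : ctx.refl β β = -β := by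
  have h := (ctx.Bhat_self_pos hβ).ne'
  rw [refl_apply _ hβ, mul_div_assoc, div_self h]
  module

lemma refl_mk {b : V} (hb : b ∈ ctx.Δ) (k : ℤ) (a : V) (m : ℚ) :
    ctx.refl (b, (k : ℚ), 0) (a, m, 0) = (a - (2 * ctx.B a b / ctx.B b b) • b,
      m - (2 * ctx.B a b / ctx.B b b) * k, 0) := by
  rw [refl_apply _ ⟨b, hb, k, rfl⟩]
  simp [Bhat_apply]

lemma Bhat_refl {β : V × ℚ × ℚ} (hβ : β ∈ ctx.Δhat) (x y : V × ℚ × ℚ) :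
    ctx.Bhat (ctx.refl β x) (ctx.refl β y) = ctx.Bhat x y := by
  have h := (ctx.Bhat_self_pos hβ).ne'
  simp only [refl_apply _ hβ, map_sub, map_smul, LinearMap.sub_apply, LinearMap.smul_apply,
    smul_eq_mul, ctx.Bhat_symm β y]
  field_simp
  ring

lemma refl_δhat {β : V × ℚ × ℚ} (hβ : β ∈ ctx.Δhat) : ctx.refl β ctx.δhat = ctx.δhat := by
  obtain ⟨b, hb, k, rfl⟩ := hβ
  rw [δhat, refl_mk _ hb]
  simp

lemma refl_mem_Δhat {β x : V × ℚ × ℚ} (hβ : β ∈ ctx.Δhat) (hx : x ∈ ctx.Δhat) :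
    ctx.refl β x ∈ ctx.Δhat := by
  obtain ⟨b, hb, k, rfl⟩ := hβ
  obtain ⟨a, ha, m, rfl⟩ := hx
  obtain ⟨n, hn⟩ := ctx.crystallographic a ha b hb
  have h := ctx.reflect_mem b hb a ha
  rw [refl_mk _ hb]
  rw [hn] at h ⊢
  exact ⟨_, h, m - n * k, by push_cast; rfl⟩

lemma refl_inv (β : V × ℚ × ℚ) : (ctx.refl β)⁻¹ = ctx.refl β := by
  rw [refl]
  split_ifs
  · rfl
  · exact Module.reflection_symm _

lemma What_induction {p : ∀ w, w ∈ ctx.What → Prop} (one : p 1 (one_mem _))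
    (mul : ∀ w β (hw : w ∈ ctx.What) (hβ : β ∈ ctx.Δhat), p w hw →
      p (w * ctx.refl β) (mul_mem hw (Subgroup.subset_closure ⟨β, hβ, rfl⟩)))
    {w} (hw : w ∈ ctx.What) : p w hw := by
  induction hw using Subgroup.closure_induction_right with
  | one => exact one
  | mul_right x hx y hy h =>
    obtain ⟨β, hβ, rfl⟩ := hy
    exact mul x β hx hβ h
  | mul_inv_cancel x hx y hy h =>
    obtain ⟨β, hβ, rfl⟩ := hy
    simpa only [refl_inv] using mul x β hx hβ h

lemma Bhat_map {w} (hw : w ∈ ctx.What) (x y : V × ℚ × ℚ) :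
    ctx.Bhat (w x) (w y) = ctx.Bhat x y := by
  induction hw using ctx.What_induction generalizing x y with
  | one => rfl
  | mul w β _ hβ ih => rw [LinearEquiv.mul_apply, LinearEquiv.mul_apply, ih, Bhat_refl _ hβ]

lemma map_δhat {w} (hw : w ∈ ctx.What) : w ctx.δhat = ctx.δhat := by
  induction hw using ctx.What_induction with
  | one => rfl
  | mul w β _ hβ ih => rw [LinearEquiv.mul_apply, refl_δhat _ hβ, ih]

lemma map_mem_Δhat {w} (hw : w ∈ ctx.What) {x : V × ℚ × ℚ} (hx : x ∈ ctx.Δhat) :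
    w x ∈ ctx.Δhat := by
  induction hw using ctx.What_induction generalizing x with
  | one => exact hx
  | mul w β _ hβ ih => exact ih (ctx.refl_mem_Δhat hβ hx)

/-- On level zero, an element of `Ŵ` shifts the coefficient of `δ` by pairing with an element of
the coroot lattice. -/
lemma exists_translation {w} (hw : w ∈ ctx.What) : ∃ z ∈ AddSubgroup.closure ctx.coroots,
    ∀ (a : V) (m : ℚ), (w (a, m, 0)).2.1 = m + ctx.B z a := by
  induction hw using ctx.What_induction with
  | one => exact ⟨0, zero_mem _, by simp⟩
  | mul w β _ hβ ih =>
    obtain ⟨z, hz, hzw⟩ := ih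
    obtain ⟨b, hb, k, rfl⟩ := hβ
    obtain ⟨n, hn⟩ := ctx.exists_int_of_mem_coroot_lattice hz hb
    have hmem : ctx.coroot b ∈ ctx.coroots := ⟨b, hb, rfl⟩
    refine ⟨z - (n + k) • ctx.coroot b,
      sub_mem hz (zsmul_mem (AddSubgroup.subset_closure hmem) _), fun a m => ?_⟩
    rw [LinearEquiv.mul_apply, refl_mk _ hb, hzw, ← Int.cast_smul_eq_zsmul ℚ]
    simp only [map_sub, map_smul, LinearMap.sub_apply, LinearMap.smul_apply, smul_eq_mul, hn,
      B_coroot, ctx.B_symm b a]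
    push_cast
    ring

/-! ### Positive affine roots -/

lemma PosHat_subset {x : V × ℚ × ℚ} (hx : x ∈ ctx.PosHat) : x ∈ ctx.Δhat := by
  rcases hx with ⟨a, ha, rfl⟩ | ⟨a, ha, k, -, rfl⟩
  · exact ⟨a, ctx.pos_subset ha, 0, by simp⟩
  · exact ⟨a, ha, k, rfl⟩

lemma SimpleHat_subset {x : V × ℚ × ℚ} (hx : x ∈ ctx.SimpleHat) : x ∈ ctx.PosHat := by
  rcases hx with ⟨a, ha, rfl⟩ | rfl
  · exact Or.inl ⟨a, ha.1, rfl⟩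
  · exact Or.inr ⟨_, ctx.neg_mem_Δ _ ctx.θ_mem, 1, le_rfl, by simp [alpha0]⟩

lemma mem_PosHat_iff {a : V} {k : ℤ} : (a, (k : ℚ), (0 : ℚ)) ∈ ctx.PosHat ↔
    (k = 0 ∧ a ∈ ctx.Pos) ∨ (1 ≤ k ∧ a ∈ ctx.Δ) := by
  constructor
  · rintro (⟨b, hb, h⟩ | ⟨b, hb, m, hm, h⟩)
    · simp only [Prod.mk.injEq, Int.cast_eq_zero] at h
      exact Or.inl ⟨h.2.1, h.1 ▸ hb⟩
    · simp only [Prod.mk.injEq, Int.cast_inj] at h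
      exact Or.inr ⟨h.2.1 ▸ hm, h.1 ▸ hb⟩
  · rintro (⟨rfl, h⟩ | ⟨hk, h⟩)
    · exact Or.inl ⟨a, h, by simp⟩
    · exact Or.inr ⟨a, h, k, hk, rfl⟩

lemma PosHat_level_nonneg {x : V × ℚ × ℚ} (hx : x ∈ ctx.PosHat) : 0 ≤ x.2.1 := by
  rcases hx with ⟨a, ha, rfl⟩ | ⟨a, ha, k, hk, rfl⟩
  · exact le_rfl
  · have : 0 ≤ k := by omega
    simpa using this

lemma neg_notMem_PosHat {x : V × ℚ × ℚ} (hx : x ∈ ctx.PosHat) : -x ∉ ctx.PosHat := by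
  intro h
  obtain ⟨a, ha, k, rfl⟩ := ctx.PosHat_subset hx
  have e : -(a, (k : ℚ), (0 : ℚ)) = (-a, ((-k : ℤ) : ℚ), (0 : ℚ)) := by simp
  rw [e, mem_PosHat_iff] at h
  rw [mem_PosHat_iff] at hx
  rcases hx with ⟨h1, h2⟩ | ⟨h1, h2⟩ <;> rcases h with ⟨h3, h4⟩ | ⟨h3, h4⟩
  · exact ctx.pos_not_neg _ h2 h4
  all_goals omega

lemma mem_PosHat_or_neg {x : V × ℚ × ℚ} (hx : x ∈ ctx.Δhat) :
    x ∈ ctx.PosHat ∨ -x ∈ ctx.PosHat := by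
  obtain ⟨a, ha, k, rfl⟩ := hx
  have e : -(a, (k : ℚ), (0 : ℚ)) = (-a, ((-k : ℤ) : ℚ), (0 : ℚ)) := by simp
  rw [e, mem_PosHat_iff, mem_PosHat_iff]
  have hn := ctx.neg_mem_Δ a ha
  rcases lt_trichotomy k 0 with h | h | h
  · exact Or.inr (Or.inr ⟨by omega, hn⟩)
  · rcases ctx.mem_pos_or_neg_pos a ha with h' | h'
    · exact Or.inl (Or.inl ⟨h, h'⟩)
    · exact Or.inr (Or.inl ⟨by omega, h'⟩)
  · exact Or.inl (Or.inr ⟨by omega, ha⟩)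

lemma add_mem_PosHat {x y : V × ℚ × ℚ} (hx : x ∈ ctx.PosHat) (hy : y ∈ ctx.PosHat)
    (h : x + y ∈ ctx.Δhat) : x + y ∈ ctx.PosHat := by
  obtain ⟨a, ha, k, rfl⟩ := ctx.PosHat_subset hx
  obtain ⟨b, hb, m, rfl⟩ := ctx.PosHat_subset hy
  have e : (a, (k : ℚ), (0 : ℚ)) + (b, (m : ℚ), (0 : ℚ)) = (a + b, ((k + m : ℤ) : ℚ), 0) := by
    simp
  have hab : a + b ∈ ctx.Δ := by
    obtain ⟨c, hc, n, h⟩ := h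
    rw [e] at h
    simp only [Prod.mk.injEq] at h
    exact h.1 ▸ hc
  rw [e, mem_PosHat_iff]
  rw [mem_PosHat_iff] at hx hy
  rcases hx with ⟨h1, h2⟩ | ⟨h1, h2⟩ <;> rcases hy with ⟨h3, h4⟩ | ⟨h3, h4⟩
  · exact Or.inl ⟨by omega, ctx.add_pos_mem a h2 b h4 hab⟩
  all_goals exact Or.inr ⟨by omega, hab⟩

/-- An affine simple reflection permutes the positive affine roots other than the simple root. -/
lemma refl_mem_PosHat {β x : V × ℚ × ℚ} (hβ : β ∈ ctx.SimpleHat) (hx : x ∈ ctx.PosHat)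
    (hne : x ≠ β) : ctx.refl β x ∈ ctx.PosHat := by
  obtain ⟨a, ha, k, rfl⟩ := ctx.PosHat_subset hx
  rw [mem_PosHat_iff] at hx
  rcases hβ with ⟨b, hb, rfl⟩ | rfl
  · have hbΔ := ctx.pos_subset hb.1
    have e := ctx.refl_mk hbΔ 0 a k
    simp only [Int.cast_zero, mul_zero, sub_zero] at e
    rw [e, mem_PosHat_iff]
    rcases hx with ⟨rfl, h⟩ | ⟨h1, h2⟩
    · exact Or.inl ⟨rfl, ctx.reflect_pos_of_simple hb h (by rintro rfl; simp at hne)⟩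
    · exact Or.inr ⟨h1, ctx.reflect_mem b hbΔ a ha⟩
  · have hnθ := ctx.neg_mem_Δ _ ctx.θ_mem
    obtain ⟨n, hn⟩ := ctx.crystallographic a ha _ hnθ
    have hmem := ctx.reflect_mem _ hnθ a ha
    have e := ctx.refl_mk hnθ 1 a k
    rw [hn] at hmem e
    have e' : ctx.refl ctx.alpha0 (a, (k : ℚ), 0) = (a - (n : ℚ) • -ctx.θ, ((k - n : ℤ) : ℚ), 0) := by
      rw [alpha0]
      push_cast at e ⊢
      simpa using e
    rw [e', mem_PosHat_iff]
    have hθ0 := ctx.B_self_pos ctx.θ_mem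
    simp only [map_neg, LinearMap.neg_apply, neg_neg] at hn
    rcases lt_trichotomy n 0 with h0 | rfl | h0
    · exact Or.inr ⟨by omega, hmem⟩
    · simpa using hx
    · have haneg : -a ∈ ctx.Pos := by
        refine (ctx.mem_pos_or_neg_pos a ha).resolve_left fun hp => ?_
        have h1 := ctx.B_θ_nonneg hp
        rw [ctx.B_symm] at h1
        have h2 : 2 * -ctx.B a ctx.θ / ctx.B ctx.θ ctx.θ ≤ 0 :=
          div_nonpos_of_nonpos_of_nonneg (by linarith) hθ0.le
        rw [hn] at h2
        have : n ≤ 0 := by exact_mod_cast h2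
        omega
      have hk : 1 ≤ k := by
        rcases hx with ⟨_, h⟩ | ⟨h, _⟩
        · exact absurd haneg (ctx.pos_not_neg a h)
        · exact h
      by_cases h2 : 2 ≤ n
      · have haθ : -a = ctx.θ := by
          apply ctx.eq_θ_of_two_le haneg
          rw [map_neg, LinearMap.neg_apply, hn]
          exact_mod_cast h2
        obtain rfl : a = -ctx.θ := by rw [← haθ, neg_neg]
        have hn2 : n = 2 := by
          have : (n : ℚ) = 2 := by
            rw [← hn, map_neg, LinearMap.neg_apply, neg_neg]; field_simp
          exact_mod_cast this
        subst hn2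
        have hk1 : k ≠ 1 := by rintro rfl; simp [alpha0] at hne
        by_cases hk2 : k = 2
        · left
          refine ⟨by omega, ?_⟩
          convert ctx.θ_pos using 1
          push_cast
          module
        · exact Or.inr ⟨by omega, hmem⟩
      · obtain rfl : n = 1 := by omega
        by_cases hk1 : k = 1
        · left
          refine ⟨by omega, (ctx.mem_pos_or_neg_pos _ hmem).resolve_right fun h => ?_⟩
          apply ctx.θ_add_notMem h
          convert ctx.neg_mem_Δ a ha using 1
          push_cast
          module
        · exact Or.inr ⟨by omega, hmem⟩

/-! ### Minuscule elements and abelian ideals -/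

lemma δ_sub_emb (γ : V) : ctx.δhat - ctx.emb γ = (-γ, ((1 : ℤ) : ℚ), (0 : ℚ)) := by
  simp [δhat, emb]

lemma δ_sub_mem_PosHat {γ : V} (hγ : γ ∈ ctx.Δ) : ctx.δhat - ctx.emb γ ∈ ctx.PosHat := by
  rw [δ_sub_emb, mem_PosHat_iff]
  exact Or.inr ⟨le_rfl, ctx.neg_mem_Δ _ hγ⟩

lemma δ_sub_injective : Function.Injective fun γ : V => ctx.δhat - ctx.emb γ := by
  intro a b h
  simpa [δ_sub_emb] using h

lemma emb_mem_PosHat {γ : V} (hγ : γ ∈ ctx.Pos) : ctx.emb γ ∈ ctx.PosHat := Or.inl ⟨γ, hγ, rfl⟩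

lemma two_δ_sub_mem_PosHat {γ : V} (hγ : γ ∈ ctx.Δ) :
    (2 : ℚ) • ctx.δhat - ctx.emb γ ∈ ctx.PosHat := by
  have e : (2 : ℚ) • ctx.δhat - ctx.emb γ = (-γ, ((2 : ℤ) : ℚ), (0 : ℚ)) := by simp [δhat, emb]
  rw [e, mem_PosHat_iff]
  exact Or.inr ⟨by norm_num, ctx.neg_mem_Δ _ hγ⟩

variable {ctx}

lemma IsMinuscule.map_mem_PosHat {w} (hw : ctx.IsMinuscule w) {x : V × ℚ × ℚ}
    (hx : x ∈ ctx.PosHat) (h : x.2.1 ≠ 1) : w x ∈ ctx.PosHat := by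
  refine (ctx.mem_PosHat_or_neg (ctx.map_mem_Δhat hw.1 (ctx.PosHat_subset hx))).resolve_right
    fun hn => h ?_
  obtain ⟨γ, _, rfl⟩ := hw.2 x ⟨hx, hn⟩
  simp [δ_sub_emb]

lemma mem_idealOf {w} {γ : V} : γ ∈ ctx.idealOf w ↔
    γ ∈ ctx.Pos ∧ -w (ctx.δhat - ctx.emb γ) ∈ ctx.PosHat :=
  ⟨fun h => ⟨h.1, h.2.2⟩, fun h => ⟨h.1, ctx.δ_sub_mem_PosHat (ctx.pos_subset h.1), h.2⟩⟩

/-- The easy half of Peterson's theorem. -/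
lemma IsMinuscule.isAbelianIdeal {w} (hw : ctx.IsMinuscule w) :
    ctx.IsAbelianIdeal (ctx.idealOf w) := by
  refine ⟨fun γ h => h.1, fun μ hμ ν hν h => ?_, fun γ hγ ν hν h => ?_⟩
  · rw [mem_idealOf] at hμ hν
    have hp := ctx.two_δ_sub_mem_PosHat h
    have hwp := hw.map_mem_PosHat hp (by simp [δhat, emb])
    refine ctx.neg_notMem_PosHat hwp ?_
    have e : -w ((2 : ℚ) • ctx.δhat - ctx.emb (μ + ν)) =
        -w (ctx.δhat - ctx.emb μ) + -w (ctx.δhat - ctx.emb ν) := by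
      rw [← map_neg, ← map_neg, ← map_neg, ← map_add]
      congr 1
      ext <;> simp [δhat, emb]
      norm_num
    rw [e]
    refine ctx.add_mem_PosHat hμ.2 hν.2 ?_
    rw [← e, ← map_neg]
    refine ctx.map_mem_Δhat hw.1 ⟨μ + ν, h, -2, ?_⟩
    simp [δhat, emb]
  · rw [mem_idealOf] at hγ ⊢
    refine ⟨ctx.add_pos_mem γ hγ.1 ν hν h, ?_⟩
    have hwν := hw.map_mem_PosHat (ctx.emb_mem_PosHat hν) (by simp [emb])
    have e : -w (ctx.δhat - ctx.emb (γ + ν)) = -w (ctx.δhat - ctx.emb γ) + w (ctx.emb ν) := by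
      rw [← map_neg, ← map_neg, ← map_add]
      congr 1
      ext <;> simp [δhat, emb]
    rw [e]
    refine ctx.add_mem_PosHat hγ.2 hwν ?_
    rw [← e, ← map_neg]
    refine ctx.map_mem_Δhat hw.1 ⟨γ + ν, h, -1, ?_⟩
    simp [δhat, emb]

/-- An elementary extension of a minuscule element. -/
lemma IsMinuscule.extend {w} (hw : ctx.IsMinuscule w) {γ : V} (hγ : γ ∈ ctx.Pos)
    (hβ : w (ctx.δhat - ctx.emb γ) ∈ ctx.SimpleHat) :
    ctx.IsMinuscule (ctx.refl (w (ctx.δhat - ctx.emb γ)) * w) ∧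
      ctx.idealOf (ctx.refl (w (ctx.δhat - ctx.emb γ)) * w) = insert γ (ctx.idealOf w) := by
  set β := w (ctx.δhat - ctx.emb γ) with hβdef
  have hβp := ctx.SimpleHat_subset hβ
  have hβΔ := ctx.PosHat_subset hβp
  have hγp := ctx.δ_sub_mem_PosHat (ctx.pos_subset hγ)
  have hN : ∀ x ∈ ctx.PosHat, -(ctx.refl β * w) x ∈ ctx.PosHat ↔
      x = ctx.δhat - ctx.emb γ ∨ -w x ∈ ctx.PosHat := by
    intro x hx
    rw [LinearEquiv.mul_apply]
    constructor
    · intro h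
      rcases ctx.mem_PosHat_or_neg (ctx.map_mem_Δhat hw.1 (ctx.PosHat_subset hx)) with h' | h'
      · left
        by_contra hne
        exact ctx.neg_notMem_PosHat (ctx.refl_mem_PosHat hβ h'
          (fun h => hne (w.injective h))) h
      · exact Or.inr h'
    · rintro (rfl | h)
      · rw [← hβdef, ctx.refl_self hβΔ, neg_neg]
        exact hβp
      · rw [← map_neg]
        refine ctx.refl_mem_PosHat hβ h fun h => ?_
        rw [← map_neg, hβdef] at h
        apply ctx.neg_notMem_PosHat hγp
        rw [← w.injective h, neg_neg]
        exact hx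
  refine ⟨⟨mul_mem (Subgroup.subset_closure ⟨β, hβΔ, rfl⟩) hw.1, fun x hx => ?_⟩, ?_⟩
  · rcases (hN x hx.1).mp hx.2 with rfl | h
    · exact ⟨γ, hγ, rfl⟩
    · exact hw.2 x ⟨hx.1, h⟩
  · ext μ
    rw [mem_idealOf, Set.mem_insert_iff, mem_idealOf]
    constructor
    · rintro ⟨h1, h2⟩
      rcases (hN _ (ctx.δ_sub_mem_PosHat (ctx.pos_subset h1))).mp h2 with h | h
      · exact Or.inl (ctx.δ_sub_injective h)
      · exact Or.inr ⟨h1, h⟩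
    · rintro (rfl | ⟨h1, h2⟩)
      · exact ⟨hγ, (hN _ hγp).mpr (Or.inl rfl)⟩
      · exact ⟨h1, (hN _ (ctx.δ_sub_mem_PosHat (ctx.pos_subset h1))).mpr (Or.inr h2)⟩

/-- If `θ ∈ I_w`, then `w(α₀) + δ` has no `δ`-component. -/
lemma IsMinuscule.level_rootlet {w} (hw : ctx.IsMinuscule w) (hθ : ctx.θ ∈ ctx.idealOf w) :
    (w ctx.alpha0).2.1 = -1 := by
  obtain ⟨z, hz, hzw⟩ := ctx.exists_translation hw.1
  have hpos : ∀ α ∈ ctx.Pos, 0 ≤ ctx.B z α := by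
    intro α hα
    have h := ctx.PosHat_level_nonneg (hw.map_mem_PosHat (ctx.emb_mem_PosHat hα) (by simp [emb]))
    simpa [emb, hzw] using h
  have hcl : ∀ x ∈ AddSubmonoid.closure ctx.Pos, 0 ≤ ctx.B z x := by
    intro x hx
    induction hx using AddSubmonoid.closure_induction with
    | mem x hx => exact hpos x hx
    | zero => simp
    | add x y _ _ hx hy => rw [map_add]; exact add_nonneg hx hy
  obtain ⟨n, hn⟩ := ctx.exists_int_of_mem_coroot_lattice hz ctx.θ_mem
  have h1 := ctx.PosHat_level_nonneg (mem_idealOf.mp hθ).2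
  rw [Prod.snd_neg, Prod.fst_neg, δ_sub_emb, hzw, map_neg, hn] at h1
  have h2 := ctx.PosHat_level_nonneg
    (hw.map_mem_PosHat (ctx.two_δ_sub_mem_PosHat ctx.θ_mem) (by simp [δhat, emb]))
  have e : (2 : ℚ) • ctx.δhat - ctx.emb ctx.θ = (-ctx.θ, (2 : ℚ), (0 : ℚ)) := by
    simp [δhat, emb]
  rw [e, hzw, map_neg, hn] at h2
  rw [alpha0, hzw, map_neg, hn]
  have h1' : 1 ≤ n := by
    have : (1 : ℚ) ≤ n := by push_cast at h1; linarith
    exact_mod_cast this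
  have h2' : n ≤ 2 := by
    have : (n : ℚ) ≤ 2 := by linarith
    exact_mod_cast this
  obtain rfl | rfl : n = 1 ∨ n = 2 := by omega
  · exfalso
    have hz0 : z = 0 := by
      refine ctx.eq_zero_of_mem_coroot_lattice hz fun α hα => ?_
      have h := hcl _ (ctx.θ_highest α hα)
      rw [map_sub, hn] at h
      push_cast at h
      linarith
    simp [hz0] at hn
  · norm_num

lemma θ_eq_add_of_abelian {I : Set V} {γ₁ γ₂ : V} (h1p : γ₁ ∈ ctx.Pos) (h2p : γ₂ ∈ ctx.Pos)
    (hI1 : ctx.IsAbelianIdeal (insert γ₁ I)) (hI2 : ctx.IsAbelianIdeal (insert γ₂ I))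
    (hadd : γ₁ + γ₂ ∈ ctx.Δ) : γ₁ + γ₂ = ctx.θ := by
  refine ctx.eq_θ_of_maximal (ctx.add_pos_mem _ h1p _ h2p hadd) fun ν hν h => ?_
  have aux : ∀ {a b : V}, ctx.IsAbelianIdeal (insert a I) → ctx.IsAbelianIdeal (insert b I) →
      a + ν ∈ ctx.Δ → a + b + ν ∉ ctx.Δ := by
    intro a b ha hb haν h
    rcases ha.2.2 a (Set.mem_insert _ _) ν hν haν with h' | h'
    · exact ctx.ne_zero_of_mem (ctx.pos_subset hν) (by simpa using h')
    · refine hb.2.1 _ (Set.mem_insert_of_mem _ h') b (Set.mem_insert _ _) ?_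
      convert h using 1
      abel
  rcases ctx.add_mem_or_add_mem h1p h2p hadd hν h with h' | h'
  · exact aux hI1 hI2 h' h
  · exact aux hI2 hI1 h' (by rwa [add_comm γ₂])

lemma isAbelianIdeal_insert_insert {I : Set V} {γ₁ γ₂ : V}
    (hI1 : ctx.IsAbelianIdeal (insert γ₁ I)) (hI2 : ctx.IsAbelianIdeal (insert γ₂ I))
    (hadd : γ₁ + γ₂ ∉ ctx.Δ) : ctx.IsAbelianIdeal (insert γ₁ (insert γ₂ I)) := by
  have hadd' : γ₂ + γ₁ ∉ ctx.Δ := by rwa [add_comm]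
  have hcover : ∀ {x}, x ∈ insert γ₁ (insert γ₂ I) ↔ x ∈ insert γ₁ I ∨ x ∈ insert γ₂ I := by
    intro x; simp only [Set.mem_insert_iff]; tauto
  refine ⟨fun x hx => (hcover.mp hx).elim (fun h => hI1.1 h) (fun h => hI2.1 h), ?_, ?_⟩
  · have a1 := hI1.2.1
    have a2 := hI2.2.1
    simp only [Set.mem_insert_iff] at a1 a2 ⊢
    rintro μ (rfl | rfl | hμ) ν (rfl | rfl | hν)
    · exact a1 _ (Or.inl rfl) _ (Or.inl rfl)
    · exact hadd
    · exact a1 _ (Or.inl rfl) _ (Or.inr hν)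
    · exact hadd'
    · exact a2 _ (Or.inl rfl) _ (Or.inl rfl)
    · exact a2 _ (Or.inl rfl) _ (Or.inr hν)
    · exact a1 _ (Or.inr hμ) _ (Or.inl rfl)
    · exact a2 _ (Or.inr hμ) _ (Or.inl rfl)
    · exact a1 _ (Or.inr hμ) _ (Or.inr hν)
  · intro γ hγ ν hν h
    rw [hcover] at hγ ⊢
    exact hγ.imp (fun hγ => hI1.2.2 γ hγ ν hν h) (fun hγ => hI2.2.2 γ hγ ν hν h)

lemma Bhat_δ_sub (a b : V) :
    ctx.Bhat (ctx.δhat - ctx.emb a) (ctx.δhat - ctx.emb b) = ctx.B a b := by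
  simp [Bhat_apply, δhat, emb]

/-- Roots which give two elementary extensions of the same ideal, jointly an abelian ideal, are
orthogonal. -/
lemma orthogonal_of_isAbelianIdeal {I : Set V} {γ₁ γ₂ : V} (hne : γ₁ ≠ γ₂)
    (h1p : γ₁ ∈ ctx.Pos) (h2p : γ₂ ∈ ctx.Pos) (h1n : γ₁ ∉ I) (h2n : γ₂ ∉ I)
    (hI1 : ctx.IsAbelianIdeal (insert γ₁ I)) (hI2 : ctx.IsAbelianIdeal (insert γ₂ I))
    (h : ctx.IsAbelianIdeal (insert γ₁ (insert γ₂ I))) : ctx.B γ₁ γ₂ = 0 := by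
  have h1 := ctx.pos_subset h1p
  have h2 := ctx.pos_subset h2p
  rcases lt_trichotomy (ctx.B γ₁ γ₂) 0 with hB | hB | hB
  · exact absurd (ctx.add_mem_of_B_neg h1 h2 hB (ctx.add_ne_zero_of_pos h1p h2p))
      (h.2.1 _ (by simp) _ (by simp))
  · exact hB
  · exfalso
    rcases ctx.mem_pos_or_neg_pos _ (ctx.sub_mem_of_B_pos h1 h2 hB hne) with hν | hν
    · have := hI2.2.2 γ₂ (by simp) _ hν (by simpa using h1)
      rw [add_sub_cancel, Set.mem_insert_iff] at this
      exact this.elim hne h1n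
    · rw [neg_sub] at hν
      have := hI1.2.2 γ₁ (by simp) _ hν (by simpa using h2)
      rw [add_sub_cancel, Set.mem_insert_iff] at this
      exact this.elim hne.symm h2n

lemma mem_SimpleHat_of_level_zero {β : V × ℚ × ℚ} (hβ : β ∈ ctx.SimpleHat) (h : β.2.1 = 0) :
    ∃ b ∈ ctx.simple, β = ctx.emb b := by
  rcases hβ with ⟨b, hb, rfl⟩ | rfl
  · exact ⟨b, hb, rfl⟩
  · simp [alpha0] at h

/-- If `γ₁ + γ₂ = θ` and `2(γ₁, γ₂) = -(γ₁, γ₁)`, then both roots are long. -/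
lemma long_of_add_eq_θ {γ₁ γ₂ : V} (h1p : γ₁ ∈ ctx.Pos) (h2p : γ₂ ∈ ctx.Pos)
    (hadd : γ₁ + γ₂ = ctx.θ) (h : 2 * ctx.B γ₁ γ₂ = -ctx.B γ₁ γ₁) :
    ctx.B γ₁ γ₁ = ctx.B ctx.θ ctx.θ ∧ ctx.B γ₂ γ₂ = ctx.B ctx.θ ctx.θ := by
  have h1 := ctx.B_self_pos (ctx.pos_subset h1p)
  have h2 := ctx.B_self_pos (ctx.pos_subset h2p)
  have hθ : ctx.B ctx.θ ctx.θ = ctx.B γ₂ γ₂ := by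
    rw [← hadd]
    simp only [map_add, LinearMap.add_apply, ctx.B_symm γ₂ γ₁]
    linarith
  refine ⟨?_, hθ.symm⟩
  have hθ2 : ctx.B ctx.θ γ₂ = ctx.B γ₁ γ₂ + ctx.B γ₂ γ₂ := by rw [← hadd]; simp
  have hnn := ctx.B_θ_nonneg h2p
  obtain ⟨n, hn⟩ := ctx.crystallographic γ₁ (ctx.pos_subset h1p) γ₂ (ctx.pos_subset h2p)
  rw [h, div_eq_iff h2.ne'] at hn
  have hn1 : n < 0 := by
    have : (n : ℚ) < 0 := by by_contra! h; nlinarith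
    exact_mod_cast this
  have hn2 : -2 ≤ n := by
    have : (-2 : ℚ) ≤ n := by by_contra! h; nlinarith
    exact_mod_cast this
  obtain rfl | rfl : n = -1 ∨ n = -2 := by omega
  · push_cast at hn; linarith
  · exfalso
    push_cast at hn
    have h0 : ctx.B (-ctx.θ) γ₂ = 0 := by
      rw [map_neg, LinearMap.neg_apply]; linarith
    refine ctx.θ_add_notMem h2p ?_
    have := ctx.neg_mem_Δ _ (ctx.sub_mem_of_orthogonal (α := -ctx.θ) (ctx.pos_subset h2p) ?_ h0)
    · convert this using 1; abel
    · convert ctx.neg_mem_Δ _ (ctx.pos_subset h1p) using 1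
      rw [← hadd]; abel

variable (ctx)

lemma refl_mul_comm {β₁ β₂ : V × ℚ × ℚ} (h1 : β₁ ∈ ctx.Δhat) (h2 : β₂ ∈ ctx.Δhat)
    (h : ctx.Bhat β₁ β₂ = 0) : ctx.refl β₁ * ctx.refl β₂ = ctx.refl β₂ * ctx.refl β₁ := by
  have h' : ctx.Bhat β₂ β₁ = 0 := by rw [Bhat_symm, h]
  apply LinearEquiv.ext
  intro x
  simp only [LinearEquiv.mul_apply, refl_apply _ h1, refl_apply _ h2, map_sub, map_smul,
    LinearMap.sub_apply, LinearMap.smul_apply, h, h', smul_zero, sub_zero]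
  abel

/-- The reflection in `β₁` sends `β₁ + β₂` to `β₂` when `⟨β₂, β₁^∨⟩ = -1`. -/
lemma refl_add_of_cartan {β₁ β₂ : V × ℚ × ℚ} (h1 : β₁ ∈ ctx.Δhat)
    (h : 2 * ctx.Bhat β₁ β₂ = -ctx.Bhat β₁ β₁) : ctx.refl β₁ (β₁ + β₂) = β₂ := by
  have h0 := (ctx.Bhat_self_pos h1).ne'
  have e : 2 * ctx.Bhat (β₁ + β₂) β₁ / ctx.Bhat β₁ β₁ = 1 := by
    rw [div_eq_one_iff_eq h0, map_add, LinearMap.add_apply, ctx.Bhat_symm β₂ β₁]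
    linarith
  rw [refl_apply _ h1, e]
  simp

variable {ctx}

/-- The case of two elementary extensions whose union is not abelian. -/
lemma IsMinuscule.rootlet_of_add_mem {w} (hw : ctx.IsMinuscule w) {γ₁ γ₂ : V} (hne : γ₁ ≠ γ₂)
    (h1p : γ₁ ∈ ctx.Pos) (h2p : γ₂ ∈ ctx.Pos) {β₁ β₂ : V × ℚ × ℚ}
    (hβ₁ : β₁ ∈ ctx.SimpleHat) (hβ₂ : β₂ ∈ ctx.SimpleHat)
    (e₁ : w (ctx.δhat - ctx.emb γ₁) = β₁) (e₂ : w (ctx.δhat - ctx.emb γ₂) = β₂)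
    (hadd : γ₁ + γ₂ ∈ ctx.Δ) :
    (∃ b₁ ∈ ctx.SimpleLong, β₁ = ctx.emb b₁) ∧ (∃ b₂ ∈ ctx.SimpleLong, β₂ = ctx.emb b₂) ∧
      w ctx.alpha0 + ctx.δhat = β₁ + β₂ ∧
      (ctx.refl β₁ * w) ctx.alpha0 + ctx.δhat = β₂ ∧
      (ctx.refl β₂ * w) ctx.alpha0 + ctx.δhat = β₁ := by
  have hβ₁Δ := ctx.PosHat_subset (ctx.SimpleHat_subset hβ₁)
  have hβ₂Δ := ctx.PosHat_subset (ctx.SimpleHat_subset hβ₂)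
  have hI1 : ctx.IsAbelianIdeal (insert γ₁ (ctx.idealOf w)) := by
    have h := hw.extend h1p (e₁.symm ▸ hβ₁)
    exact h.2 ▸ h.1.isAbelianIdeal
  have hI2 : ctx.IsAbelianIdeal (insert γ₂ (ctx.idealOf w)) := by
    have h := hw.extend h2p (e₂.symm ▸ hβ₂)
    exact h.2 ▸ h.1.isAbelianIdeal
  have hθ := θ_eq_add_of_abelian h1p h2p hI1 hI2 hadd
  have hθI : ctx.θ ∈ ctx.idealOf w := by
    have h := hI1.2.2 γ₁ (by simp) γ₂ h2p hadd
    rw [hθ, Set.mem_insert_iff] at h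
    refine h.resolve_left fun h => ctx.ne_zero_of_mem (ctx.pos_subset h2p) ?_
    rwa [← hθ, add_eq_left] at h
  have hsum : w ctx.alpha0 + ctx.δhat = β₁ + β₂ := by
    rw [← e₁, ← e₂, ← ctx.map_δhat hw.1, ← map_add, ← map_add, ctx.map_δhat hw.1]
    congr 1
    ext <;> simp [alpha0, δhat, emb, ← hθ]
    abel
  have hlev : β₁.2.1 + β₂.2.1 = 0 := by
    have h := congrArg (fun x : V × ℚ × ℚ => x.2.1) hsum
    simp only [Prod.snd_add, Prod.fst_add, hw.level_rootlet hθI] at h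
    rw [← h]
    simp [δhat]
  have hn1 := ctx.PosHat_level_nonneg (ctx.SimpleHat_subset hβ₁)
  have hn2 := ctx.PosHat_level_nonneg (ctx.SimpleHat_subset hβ₂)
  obtain ⟨b₁, hb₁, hb₁e⟩ := mem_SimpleHat_of_level_zero hβ₁ (by linarith)
  obtain ⟨b₂, hb₂, hb₂e⟩ := mem_SimpleHat_of_level_zero hβ₂ (by linarith)
  have hBe : ∀ a b, ctx.Bhat (ctx.emb a) (ctx.emb b) = ctx.B a b := by
    intro a b; simp [Bhat_apply, emb]
  have hB11 : ctx.Bhat β₁ β₁ = ctx.B γ₁ γ₁ := by rw [← e₁, ctx.Bhat_map hw.1, Bhat_δ_sub]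
  have hB22 : ctx.Bhat β₂ β₂ = ctx.B γ₂ γ₂ := by rw [← e₂, ctx.Bhat_map hw.1, Bhat_δ_sub]
  have hB12 : ctx.Bhat β₁ β₂ = ctx.B γ₁ γ₂ := by rw [← e₁, ← e₂, ctx.Bhat_map hw.1, Bhat_δ_sub]
  have hbne : b₁ ≠ b₂ := by
    rintro rfl
    rw [← e₁] at hb₁e
    rw [← e₂, ← hb₁e] at hb₂e
    exact hne (ctx.δ_sub_injective (w.injective hb₂e)).symm
  have hbadd : b₁ + b₂ ∈ ctx.Δ := by
    obtain ⟨a, ha, k, hk⟩ := ctx.map_mem_Δhat hw.1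
      (ctx.PosHat_subset (ctx.two_δ_sub_mem_PosHat ctx.θ_mem))
    have e : w ((2 : ℚ) • ctx.δhat - ctx.emb ctx.θ) = β₁ + β₂ := by
      rw [← hsum]
      nth_rw 2 [← ctx.map_δhat hw.1]
      rw [← map_add]
      congr 1
      ext <;> simp [alpha0, δhat, emb]
      norm_num
    rw [e, hb₁e, hb₂e] at hk
    have h := congrArg Prod.fst hk
    simp only [emb, Prod.fst_add] at h
    rwa [h]
  have hBneg : ctx.B γ₁ γ₂ < 0 := by
    rw [← hB12, hb₁e, hb₂e, hBe]
    exact ctx.B_neg_of_simple hb₁ hb₂ hbne hbadd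
  have hlong : ctx.B γ₁ γ₁ = ctx.B ctx.θ ctx.θ ∧ ctx.B γ₂ γ₂ = ctx.B ctx.θ ctx.θ := by
    rcases ctx.cartan_eq_neg_one (ctx.pos_subset h1p) (ctx.pos_subset h2p) hBneg
      (ctx.add_ne_zero_of_pos h1p h2p) with h | h
    · exact (long_of_add_eq_θ h2p h1p (by rw [add_comm, hθ]) (by rw [ctx.B_symm, h])).symm
    · exact long_of_add_eq_θ h1p h2p hθ h
  have hB : 2 * ctx.B γ₁ γ₂ = -ctx.B ctx.θ ctx.θ := by
    have h := hlong
    rcases ctx.cartan_eq_neg_one (ctx.pos_subset h1p) (ctx.pos_subset h2p) hBneg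
      (ctx.add_ne_zero_of_pos h1p h2p) with h' | h'
    · rw [h', h.2]
    · rw [h', h.1]
  refine ⟨⟨b₁, ⟨hb₁, ?_⟩, hb₁e⟩, ⟨b₂, ⟨hb₂, ?_⟩, hb₂e⟩, hsum, ?_, ?_⟩
  · rw [← hBe, ← hb₁e, hB11, hlong.1]
  · rw [← hBe, ← hb₂e, hB22, hlong.2]
  · rw [← ctx.refl_δhat hβ₁Δ]
    rw [LinearEquiv.mul_apply, ← map_add, hsum]
    exact ctx.refl_add_of_cartan hβ₁Δ (by rw [hB12, hB, hB11, hlong.1])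
  · rw [← ctx.refl_δhat hβ₂Δ]
    rw [LinearEquiv.mul_apply, ← map_add, hsum, add_comm]
    exact ctx.refl_add_of_cartan hβ₂Δ (by rw [ctx.Bhat_symm, hB12, hB, hB22, hlong.2])

end RootSystemCtx

/-- Proposition `compose`: behaviour of two different
elementary extensions `I_w ∪ {γ₁}`, `I_w ∪ {γ₂}` of a given abelian ideal. -/
theorem statement_10 {V : Type*} [AddCommGroup V] [Module ℚ V] (ctx : RootSystemCtx V)
    (w : (V × ℚ × ℚ) ≃ₗ[ℚ] (V × ℚ × ℚ)) (hw : ctx.IsMinuscule w)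
    (γ₁ γ₂ : V) (hγne : γ₁ ≠ γ₂)
    (h1p : γ₁ ∈ ctx.Pos) (h2p : γ₂ ∈ ctx.Pos)
    (h1n : γ₁ ∉ ctx.idealOf w) (h2n : γ₂ ∉ ctx.idealOf w)
    (β₁ β₂ : V × ℚ × ℚ) (hβ₁ : β₁ ∈ ctx.SimpleHat) (hβ₂ : β₂ ∈ ctx.SimpleHat)
    (e₁ : w (ctx.δhat - ctx.emb γ₁) = β₁) (e₂ : w (ctx.δhat - ctx.emb γ₂) = β₂) :
    (¬ctx.IsAbelianIdeal (insert γ₁ (insert γ₂ (ctx.idealOf w))) →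
      (∃ b₁ ∈ ctx.SimpleLong, β₁ = ctx.emb b₁) ∧
      (∃ b₂ ∈ ctx.SimpleLong, β₂ = ctx.emb b₂) ∧
      w ctx.alpha0 + ctx.δhat = β₁ + β₂ ∧
      (ctx.refl β₁ * w) ctx.alpha0 + ctx.δhat = β₂ ∧
      (ctx.refl β₂ * w) ctx.alpha0 + ctx.δhat = β₁) ∧
    (ctx.IsAbelianIdeal (insert γ₁ (insert γ₂ (ctx.idealOf w))) →
      ctx.refl β₁ * ctx.refl β₂ = ctx.refl β₂ * ctx.refl β₁ ∧
      ctx.IsMinuscule (ctx.refl β₁ * ctx.refl β₂ * w) ∧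
      ctx.idealOf (ctx.refl β₁ * ctx.refl β₂ * w) =
        insert γ₁ (insert γ₂ (ctx.idealOf w))) ∧
    ((ctx.refl β₁ * w) ctx.alpha0 = w ctx.alpha0 →
      ctx.IsAbelianIdeal (insert γ₁ (insert γ₂ (ctx.idealOf w))) ∧
      (ctx.refl β₁ * ctx.refl β₂ * w) ctx.alpha0 = (ctx.refl β₂ * w) ctx.alpha0) := by
  have hβ₁Δ := ctx.PosHat_subset (ctx.SimpleHat_subset hβ₁)
  have hβ₂Δ := ctx.PosHat_subset (ctx.SimpleHat_subset hβ₂)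
  have hx1 := hw.extend h1p (e₁.symm ▸ hβ₁)
  have hx2 := hw.extend h2p (e₂.symm ▸ hβ₂)
  rw [e₁] at hx1
  rw [e₂] at hx2
  have hI1 := hx1.2 ▸ hx1.1.isAbelianIdeal
  have hI2 := hx2.2 ▸ hx2.1.isAbelianIdeal
  have hadd : ¬ctx.IsAbelianIdeal (insert γ₁ (insert γ₂ (ctx.idealOf w))) → γ₁ + γ₂ ∈ ctx.Δ :=
    fun h => by_contra fun h' => h (RootSystemCtx.isAbelianIdeal_insert_insert hI1 hI2 h')
  have horth : ctx.IsAbelianIdeal (insert γ₁ (insert γ₂ (ctx.idealOf w))) →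
      ctx.Bhat β₁ β₂ = 0 := by
    intro h
    rw [← e₁, ← e₂, ctx.Bhat_map hw.1, RootSystemCtx.Bhat_δ_sub]
    exact RootSystemCtx.orthogonal_of_isAbelianIdeal hγne h1p h2p h1n h2n hI1 hI2 h
  have h1 := fun h => hw.rootlet_of_add_mem hγne h1p h2p hβ₁ hβ₂ e₁ e₂ (hadd h)
  refine ⟨h1, fun h => ⟨ctx.refl_mul_comm hβ₁Δ hβ₂Δ (horth h), ?_⟩, fun h3 => ?_⟩
  · have e : (ctx.refl β₂ * w) (ctx.δhat - ctx.emb γ₁) = β₁ := by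
      rw [LinearEquiv.mul_apply, e₁, ctx.refl_apply hβ₂Δ, horth h]
      simp
    have hx := hx2.1.extend h1p (e.symm ▸ hβ₁)
    rw [e, ← mul_assoc, hx2.2] at hx
    exact hx
  · have h : ctx.IsAbelianIdeal (insert γ₁ (insert γ₂ (ctx.idealOf w))) := by
      by_contra h
      obtain ⟨-, -, hs, hs1, -⟩ := h1 h
      rw [h3, hs] at hs1
      have h0 := ctx.Bhat_self_pos hβ₁Δ
      rw [add_eq_right.mp hs1] at h0
      simp at h0
    refine ⟨h, ?_⟩
    rw [ctx.refl_mul_comm hβ₁Δ hβ₂Δ (horth h), mul_assoc, LinearEquiv.mul_apply, h3]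
    rfl
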